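/- For all integers k ≥ 2 and n with n > 2k+1, one has b(k) < o(n). (This expresses that the number of nilpotent orbits in a Lie algebra of type B_k is smaller than the number of nilpotent orbits in any classical simple Lie algebra having an irreducible module of dimension n > 2k+1.) -/

import Mathlib

/-- The number of partitions of `n`: multisets of positive integers with sum `n`. -/
noncomputable def numPartitions (n : ℕ) : ℕ :=
  Nat.card {l : Multiset ℕ // (∀ i ∈ l, 0 < i) ∧ l.sum = n}

/-- `a n` is the number of partitions of `n + 1`, i.e. the number of nilpotent
adjoint orbits in the simple complex Lie algebra of type `A_n`. -/
noncomputable def a (n : ℕ) : ℕ := numPartitions (n + 1)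

/-- `b m` is the number of pairs `(λ, μ)` of partitions with `2|λ| + |μ| = 2m + 1`
where the parts of `μ` are pairwise distinct and all odd; this is the number of
nilpotent adjoint orbits in type `B_m`. -/
noncomputable def b (m : ℕ) : ℕ :=
  Nat.card {p : Multiset ℕ × Multiset ℕ //
    (∀ i ∈ p.1, 0 < i) ∧ (∀ i ∈ p.2, 0 < i) ∧ p.2.Nodup ∧ (∀ i ∈ p.2, Odd i) ∧
    2 * p.1.sum + p.2.sum = 2 * m + 1}

/-- `c m` is the number of pairs `(λ, μ)` of partitions with `|λ| + |μ| = m`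
where the parts of `μ` are pairwise distinct; this is the number of
nilpotent adjoint orbits in type `C_m`. -/
noncomputable def c (m : ℕ) : ℕ :=
  Nat.card {p : Multiset ℕ × Multiset ℕ //
    (∀ i ∈ p.1, 0 < i) ∧ (∀ i ∈ p.2, 0 < i) ∧ p.2.Nodup ∧
    p.1.sum + p.2.sum = m}

/-- `d m` is the number of pairs `(λ, μ)` of partitions with `2|λ| + |μ| = 2m`
where the parts of `μ` are pairwise distinct and all odd; this is the number of
nilpotent adjoint orbits in type `D_m`. -/
noncomputable def d (m : ℕ) : ℕ :=
  Nat.card {p : Multiset ℕ × Multiset ℕ //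
    (∀ i ∈ p.1, 0 < i) ∧ (∀ i ∈ p.2, 0 < i) ∧ p.2.Nodup ∧ (∀ i ∈ p.2, Odd i) ∧
    2 * p.1.sum + p.2.sum = 2 * m}

/-- `o n` is the lower bound for the number of nilpotent adjoint orbits in a
classical simple Lie algebra having an (irreducible, self-dual as appropriate)
module of dimension `n`. -/
noncomputable def o (n : ℕ) : ℕ :=
  if Odd n then min (a (n - 1)) (b ((n - 1) / 2))
  else min (a (n - 1)) (min (c (n / 2)) (d (n / 2)))

section Counting

variable {α β : Type*} {p : α → Prop} {q : β → Prop}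

theorem natCard_le_of_injOn (hq : {y | q y}.Finite) (f : α → β)
    (hf : ∀ x, p x → q (f x)) (inj : ∀ x y, p x → p y → f x = f y → x = y) :
    Nat.card {x // p x} ≤ Nat.card {y // q y} := by
  have : Finite {y // q y} := hq
  refine Nat.card_le_card_of_injective (fun x : {x // p x} ↦ (⟨f x, hf x x.2⟩ : {y // q y})) ?_
  intro x y h
  exact Subtype.ext (inj x y x.2 y.2 (congrArg Subtype.val h))

theorem natCard_lt_of_injOn (hq : {y | q y}.Finite) (f : α → β)
    (hf : ∀ x, p x → q (f x)) (inj : ∀ x y, p x → p y → f x = f y → x = y)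
    (z : β) (hz : q z) (hfz : ∀ x, p x → f x ≠ z) :
    Nat.card {x // p x} < Nat.card {y // q y} := by
  have hlt : Nat.card {y // q y ∧ y ≠ z} < Nat.card {y // q y} :=
    Set.ncard_lt_ncard (s := {y | q y ∧ y ≠ z}) (t := {y | q y})
      ⟨fun y hy ↦ hy.1, fun h ↦ (h hz).2 rfl⟩ hq
  exact (natCard_le_of_injOn (hq.subset fun y hy ↦ hy.1) f
    (fun x hx ↦ ⟨hf x hx, hfz x hx⟩) inj).trans_lt hlt

end Counting

theorem finite_multiset_pos_sum_eq (n : ℕ) :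
    {l : Multiset ℕ | (∀ i ∈ l, 0 < i) ∧ l.sum = n}.Finite := by
  refine (Set.finite_range (fun P : n.Partition ↦ P.parts)).subset ?_
  rintro l ⟨h, hs⟩
  exact ⟨⟨l, fun {i} hi ↦ h i hi, hs⟩, rfl⟩

theorem finite_multiset_pos_sum_le (n : ℕ) :
    {l : Multiset ℕ | (∀ i ∈ l, 0 < i) ∧ l.sum ≤ n}.Finite := by
  refine ((Set.finite_Iic n).biUnion fun m _ ↦ finite_multiset_pos_sum_eq m).subset ?_
  rintro l ⟨h, hs⟩
  simp only [Set.mem_iUnion]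
  exact ⟨l.sum, hs, h, rfl⟩

theorem finite_multiset_pairs (n : ℕ) {q : Multiset ℕ × Multiset ℕ → Prop}
    (h : ∀ p, q p → (∀ i ∈ p.1, 0 < i) ∧ (∀ i ∈ p.2, 0 < i) ∧ p.1.sum + p.2.sum ≤ n) :
    {p | q p}.Finite := by
  refine ((finite_multiset_pos_sum_le n).prod (finite_multiset_pos_sum_le n)).subset ?_
  intro p hp
  obtain ⟨h₁, h₂, h₃⟩ := h p hp
  exact ⟨⟨h₁, by omega⟩, ⟨h₂, by omega⟩⟩

theorem numPartitions_mono : Monotone numPartitions := by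
  refine monotone_nat_of_le_succ fun n ↦ ?_
  refine natCard_le_of_injOn (finite_multiset_pos_sum_eq (n + 1)) (fun l ↦ 1 ::ₘ l) ?_ ?_
  · rintro l ⟨h, hs⟩
    refine ⟨by simpa using h, ?_⟩
    simp only [Multiset.sum_cons]
    omega
  · rintro l l' - - h
    simpa using h

theorem c_mono : Monotone c := by
  refine monotone_nat_of_le_succ fun n ↦ ?_
  refine natCard_le_of_injOn
    (finite_multiset_pairs (n + 1) fun p hp ↦ ⟨hp.1, hp.2.1, hp.2.2.2.le⟩)
    (fun p ↦ (1 ::ₘ p.1, p.2)) ?_ ?_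
  · rintro ⟨l, m⟩ ⟨h₁, h₂, h₃, hs⟩
    refine ⟨by simpa using h₁, h₂, h₃, ?_⟩
    simp only [Multiset.sum_cons] at hs ⊢
    omega
  · rintro ⟨l, m⟩ ⟨l', m'⟩ - - h
    simpa using h

theorem finite_odd_pairs (n : ℕ) :
    {p : Multiset ℕ × Multiset ℕ | (∀ i ∈ p.1, 0 < i) ∧ (∀ i ∈ p.2, 0 < i) ∧ p.2.Nodup ∧
      (∀ i ∈ p.2, Odd i) ∧ 2 * p.1.sum + p.2.sum = n}.Finite :=
  finite_multiset_pairs n fun _ hp ↦ ⟨hp.1, hp.2.1, by have := hp.2.2.2.2; omega⟩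

theorem d_mono : Monotone d := by
  refine monotone_nat_of_le_succ fun n ↦ ?_
  refine natCard_le_of_injOn (finite_odd_pairs (2 * (n + 1))) (fun p ↦ (1 ::ₘ p.1, p.2)) ?_ ?_
  · rintro ⟨l, m⟩ ⟨h₁, h₂, h₃, h₄, hs⟩
    refine ⟨by simpa using h₁, h₂, h₃, h₄, ?_⟩
    simp only [Multiset.sum_cons] at hs ⊢
    omega
  · rintro ⟨l, m⟩ ⟨l', m'⟩ - - h
    simpa using h

theorem b_strictMono : StrictMono b := by
  refine strictMono_nat_of_lt_succ fun n ↦ ?_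
  refine natCard_lt_of_injOn (finite_odd_pairs (2 * (n + 1) + 1)) (fun p ↦ (1 ::ₘ p.1, p.2))
    ?_ ?_ (0, {2 * (n + 1) + 1}) ?_ ?_
  · rintro ⟨l, m⟩ ⟨h₁, h₂, h₃, h₄, hs⟩
    refine ⟨by simpa using h₁, h₂, h₃, h₄, ?_⟩
    simp only [Multiset.sum_cons] at hs ⊢
    omega
  · rintro ⟨l, m⟩ ⟨l', m'⟩ - - h
    simpa using h
  · simp
  · rintro ⟨l, m⟩ - h
    simp at h

/-- Toggling the part `1` of `μ`, and adding a part `1` to `λ` whenever it was removed from `μ`,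
raises `2|λ| + |μ|` by one. -/
theorem b_lt_d_succ {k : ℕ} (hk : 1 ≤ k) : b k < d (k + 1) := by
  refine natCard_lt_of_injOn (finite_odd_pairs (2 * (k + 1)))
    (fun p ↦ if 1 ∈ p.2 then (1 ::ₘ p.1, p.2.erase 1) else (p.1, 1 ::ₘ p.2))
    ?_ ?_ ({k + 1}, 0) ?_ ?_
  · rintro ⟨l, m⟩ ⟨h₁, h₂, h₃, h₄, hs⟩
    simp only at h₁ h₂ h₃ h₄ hs
    by_cases h : 1 ∈ m
    · have := Multiset.sum_erase h
      simp only [h, if_true]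
      refine ⟨by simpa using h₁, fun i hi ↦ h₂ i (Multiset.mem_of_mem_erase hi), h₃.erase 1,
        fun i hi ↦ h₄ i (Multiset.mem_of_mem_erase hi), ?_⟩
      simp only [Multiset.sum_cons]
      omega
    · simp only [h, if_false]
      refine ⟨h₁, by simpa using h₂, by simp [h, h₃], by simpa using h₄, ?_⟩
      simp only [Multiset.sum_cons]
      omega
  · rintro ⟨l, m⟩ ⟨l', m'⟩ ⟨-, -, h₃, -⟩ ⟨-, -, h₃', -⟩ h
    simp only at h h₃ h₃'
    split_ifs at h with h1 h2 h2
    · simp only [Prod.mk.injEq, Multiset.cons_inj_right] at h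
      rw [h.1, ← Multiset.cons_erase h1, h.2, Multiset.cons_erase h2]
    · have := congrArg Prod.snd h
      simp only at this
      exact absurd (this ▸ Multiset.mem_cons_self 1 m') h₃.notMem_erase
    · have := congrArg Prod.snd h
      simp only at this
      exact absurd (this ▸ Multiset.mem_cons_self 1 m) h₃'.notMem_erase
    · simpa using h
  · simp
  · rintro ⟨l, m⟩ - h
    simp only at h
    split_ifs at h
    · have hl : 1 ::ₘ l = {k + 1} := congrArg Prod.fst h
      have h1 : 1 ∈ ({k + 1} : Multiset ℕ) := hl ▸ Multiset.mem_cons_self 1 l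
      rw [Multiset.mem_singleton] at h1
      omega
    · simp at h

theorem sum_eq_of_forall_odd (m : Multiset ℕ) (h : ∀ i ∈ m, Odd i) :
    m.sum = 2 * (m.map (· / 2)).sum + m.card := by
  induction m using Multiset.induction_on with
  | empty => simp
  | cons i m ih =>
    have := ih fun j hj ↦ h j (Multiset.mem_cons_of_mem hj)
    obtain ⟨t, rfl⟩ := h i (Multiset.mem_cons_self i m)
    simp only [Multiset.sum_cons, Multiset.map_cons, Multiset.card_cons]
    omega

theorem map_half_inj {m m' : Multiset ℕ} (h : ∀ i ∈ m, Odd i) (h' : ∀ i ∈ m', Odd i)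
    (hm : m.map (· / 2) = m'.map (· / 2)) : m = m' := by
  have key : ∀ s : Multiset ℕ, (∀ i ∈ s, Odd i) → (s.map (· / 2)).map (2 * · + 1) = s := by
    intro s hs
    rw [Multiset.map_map]
    conv_rhs => rw [← Multiset.map_id s]
    refine Multiset.map_congr rfl fun i hi ↦ ?_
    exact Nat.two_mul_div_two_add_one_of_odd (hs i hi)
  rw [← key m h, hm, key m' h']

theorem nodup_map_half {m : Multiset ℕ} (h : ∀ i ∈ m, Odd i) (hm : m.Nodup) :
    (m.map (· / 2)).Nodup := by
  refine Multiset.Nodup.map_on (fun x hx y hy hxy ↦ ?_) hm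
  have := Nat.odd_iff.1 (h x hx)
  have := Nat.odd_iff.1 (h y hy)
  omega

theorem filter_ne_zero_add_replicate (s : Multiset ℕ) :
    s.filter (· ≠ 0) + Multiset.replicate (s.count 0) 0 = s := by
  have h := Multiset.filter_add_not (· ≠ 0) s
  simp only [ne_eq, not_not] at h
  rwa [Multiset.filter_eq' s 0] at h

theorem eq_of_filter_ne_zero_eq {s t : Multiset ℕ} (hs : s.Nodup) (ht : t.Nodup)
    (hcard : s.card % 2 = t.card % 2) (h : s.filter (· ≠ 0) = t.filter (· ≠ 0)) : s = t := by
  have es := filter_ne_zero_add_replicate s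
  have et := filter_ne_zero_add_replicate t
  have cs := congrArg Multiset.card es
  have ct := congrArg Multiset.card et
  have := Multiset.nodup_iff_count_le_one.1 hs 0
  have := Multiset.nodup_iff_count_le_one.1 ht 0
  simp only [Multiset.card_add, Multiset.card_replicate] at cs ct
  rw [h] at cs
  rw [← es, ← et, h, show s.count 0 = t.count 0 by omega]

/-- Halve the parts of `μ` and compensate by adding `(r + 1) / 2` parts `1` to `λ`, where `r` is
the (odd) number of parts of `μ`. -/
theorem b_lt_c_succ (k : ℕ) : b k < c (k + 1) := by
  refine natCard_lt_of_injOn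
    (finite_multiset_pairs (k + 1) fun p hp ↦ ⟨hp.1, hp.2.1, hp.2.2.2.le⟩)
    (fun p ↦ (p.1 + Multiset.replicate ((p.2.card + 1) / 2) 1,
      (p.2.map (· / 2)).filter (· ≠ 0))) ?_ ?_ (0, {k + 1}) ?_ ?_
  · rintro ⟨l, m⟩ ⟨h₁, -, h₃, h₄, hs⟩
    simp only at h₁ h₃ h₄ hs
    refine ⟨?_, ?_, (nodup_map_half h₄ h₃).filter _, ?_⟩
    · intro i hi
      rcases Multiset.mem_add.1 hi with hi | hi
      · exact h₁ i hi
      · rw [Multiset.eq_of_mem_replicate hi]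
        exact one_pos
    · intro i hi
      exact Nat.pos_of_ne_zero (Multiset.mem_filter.1 hi).2
    · have e := congrArg Multiset.sum (filter_ne_zero_add_replicate (m.map (· / 2)))
      have := sum_eq_of_forall_odd m h₄
      simp only [Multiset.sum_add, Multiset.sum_replicate, smul_eq_mul, mul_zero, mul_one] at e ⊢
      omega
  · rintro ⟨l, m⟩ ⟨l', m'⟩ ⟨-, -, h₃, h₄, hs⟩ ⟨-, -, h₃', h₄', hs'⟩ h
    simp only at h₃ h₄ hs h₃' h₄' hs'
    have := sum_eq_of_forall_odd m h₄
    have := sum_eq_of_forall_odd m' h₄'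
    have hm : m = m' := by
      refine map_half_inj h₄ h₄' (eq_of_filter_ne_zero_eq (nodup_map_half h₄ h₃)
        (nodup_map_half h₄' h₃') ?_ (congrArg Prod.snd h))
      simp only [Multiset.card_map]
      omega
    subst hm
    have := congrArg Prod.fst h
    simp only [add_left_inj] at this
    rw [this]
  · simp
  · rintro ⟨l, m⟩ ⟨-, -, -, h₄, hs⟩ h
    have := sum_eq_of_forall_odd m h₄
    have hc := congrArg (fun p ↦ Multiset.card p.1) h
    simp only [Multiset.card_add, Multiset.card_replicate, Multiset.card_zero] at hc hs
    omega

theorem filter_even_map_double_add (l m : Multiset ℕ) (h : ∀ i ∈ m, Odd i) :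
    (l.map (2 * ·) + m).filter Even = l.map (2 * ·) := by
  rw [Multiset.filter_add, Multiset.filter_eq_self.2, Multiset.filter_eq_nil.2, add_zero]
  · exact fun i hi ↦ Nat.not_even_iff_odd.2 (h i hi)
  · intro i hi
    obtain ⟨j, -, rfl⟩ := Multiset.mem_map.1 hi
    exact even_two_mul j

/-- Double the parts of `λ`, merge them with those of `μ` and add a part `1`. -/
theorem b_lt_numPartitions (k : ℕ) : b k < numPartitions (2 * k + 2) := by
  refine natCard_lt_of_injOn (finite_multiset_pos_sum_eq (2 * k + 2))
    (fun p ↦ 1 ::ₘ (p.1.map (2 * ·) + p.2)) ?_ ?_ {2 * k + 2} ?_ ?_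
  · rintro ⟨l, m⟩ ⟨h₁, h₂, -, -, hs⟩
    simp only at h₁ h₂ hs
    refine ⟨?_, ?_⟩
    · intro i hi
      simp only [Multiset.mem_cons, Multiset.mem_add, Multiset.mem_map] at hi
      rcases hi with rfl | ⟨j, hj, rfl⟩ | hi
      · exact one_pos
      · have := h₁ j hj
        omega
      · exact h₂ i hi
    · have hl : (l.map (2 * ·)).sum = 2 * l.sum := by
        simpa using Multiset.sum_map_mul_left (s := l) (a := 2) (f := id)
      simp only [Multiset.sum_cons, Multiset.sum_add, hl]
      omega
  · rintro ⟨l, m⟩ ⟨l', m'⟩ ⟨-, -, -, h₄, -⟩ ⟨-, -, -, h₄', -⟩ h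
    simp only [Multiset.cons_inj_right] at h h₄ h₄'
    have hl : l.map (2 * ·) = l'.map (2 * ·) := by
      rw [← filter_even_map_double_add l m h₄, h, filter_even_map_double_add l' m' h₄']
    rw [hl, add_right_inj] at h
    rw [h, Multiset.map_injective (mul_right_injective₀ two_ne_zero) hl]
  · simp
  · rintro ⟨l, m⟩ - h
    have h1 : 1 ∈ ({2 * k + 2} : Multiset ℕ) := h ▸ Multiset.mem_cons_self 1 _
    simp at h1

theorem stmt_7 : ∀ k n : ℕ, 2 ≤ k → 2 * k + 1 < n → b k < o n := by
  intro k n hk hn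
  have ha : b k < a (n - 1) := (b_lt_numPartitions k).trans_le (numPartitions_mono (by omega))
  unfold o
  split_ifs with h
  · obtain ⟨t, rfl⟩ := h
    exact lt_min ha (b_strictMono (by omega))
  · exact lt_min ha (lt_min ((b_lt_c_succ k).trans_le (c_mono (by omega)))
      ((b_lt_d_succ (by omega)).trans_le (d_mono (by omega))))
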